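/- If the weighted Sobolev inequality (∫_E |u|^q ω dx)^{1/q} ≤ K₀ (∫_E |∇u|^p σ dx)^{1/p} holds for all u ∈ C₀^∞(ℝⁿ) with E an open convex cone, ω, σ continuous positive weights on E homogeneous of degrees τ and α, then τ/q ≤ α/p (equivalently, under the balance condition, α ≥ (1 − p/n)τ). -/

import Mathlib

open MeasureTheory

/-- Integrating a bump translated far along a ray of an open cone against a positive continuous
weight which is homogeneous of degree `τ` gives a quantity of order `δ ^ τ`. -/
theorem exists_bounds_setIntegral_translate_mul_homogeneous
    {F : Type*} [NormedAddCommGroup F] [NormedSpace ℝ F] [FiniteDimensional ℝ F]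
    [MeasurableSpace F] [BorelSpace F] (μ : Measure F) [μ.IsAddHaarMeasure]
    {E : Set F} (hEopen : IsOpen E) (hcone : ∀ l : ℝ, 0 < l → ∀ x ∈ E, l • x ∈ E)
    {y : F} (hy : y ∈ E) {w : F → ℝ} {τ : ℝ}
    (hwpos : ∀ x ∈ E, 0 < w x) (hwcont : ContinuousOn w E)
    (hwhom : ∀ l : ℝ, 0 < l → ∀ x ∈ E, w (l • x) = l ^ τ * w x)
    {g : F → ℝ} (hgcont : Continuous g) (hgnonneg : ∀ x, 0 ≤ g x)
    (hgsupp : ∀ x, x ∉ Metric.closedBall (0 : F) 1 → g x = 0) :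
    ∃ m M : ℝ, 0 < m ∧ 0 < M ∧ ∀ᶠ δ : ℝ in Filter.atTop,
      δ ^ τ * m * ∫ x, g x ∂μ ≤ ∫ x in E, g (x - δ • y) * w x ∂μ ∧
      ∫ x in E, g (x - δ • y) * w x ∂μ ≤ δ ^ τ * M * ∫ x, g x ∂μ := by
  obtain ⟨r, hr, hrE⟩ := Metric.nhds_basis_closedBall.mem_iff.1 (hEopen.mem_nhds hy)
  have hcomp : IsCompact (Metric.closedBall y r) := isCompact_closedBall y r
  have hne : (Metric.closedBall y r).Nonempty := ⟨y, Metric.mem_closedBall_self hr.le⟩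
  obtain ⟨a, ha, hamin⟩ := hcomp.exists_isMinOn hne (hwcont.mono hrE)
  obtain ⟨b, hb, hbmax⟩ := hcomp.exists_isMaxOn hne (hwcont.mono hrE)
  refine ⟨w a, w b, hwpos a (hrE ha), hwpos b (hrE hb), ?_⟩
  filter_upwards [Filter.eventually_ge_atTop (1 / r), Filter.eventually_gt_atTop 0] with δ hδr hδ
  set K := Metric.closedBall (δ • y) 1 with hK
  have hscale : ∀ x ∈ K, δ⁻¹ • x ∈ Metric.closedBall y r := by
    intro x hx
    rw [hK, mem_closedBall_iff_norm] at hx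
    rw [mem_closedBall_iff_norm]
    have h : δ⁻¹ • x - y = δ⁻¹ • (x - δ • y) := by
      rw [smul_sub, inv_smul_smul₀ hδ.ne']
    rw [h, norm_smul, Real.norm_of_nonneg (inv_nonneg.2 hδ.le), inv_mul_le_iff₀ hδ]
    rw [div_le_iff₀ hr] at hδr
    linarith
  have hw : ∀ x ∈ K, w x = δ ^ τ * w (δ⁻¹ • x) := by
    intro x hx
    rw [← hwhom δ hδ _ (hrE (hscale x hx)), smul_inv_smul₀ hδ.ne']
  have hKE : K ⊆ E := by
    intro x hx
    simpa [smul_inv_smul₀ hδ.ne'] using hcone δ hδ _ (hrE (hscale x hx))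
  have hzero : ∀ x, x ∉ K → g (x - δ • y) = 0 := by
    intro x hx
    refine hgsupp _ fun h => hx ?_
    rwa [hK, mem_closedBall_iff_norm, ← mem_closedBall_zero_iff]
  have hEK : ∫ x in E, g (x - δ • y) * w x ∂μ = ∫ x in K, g (x - δ • y) * w x ∂μ :=
    setIntegral_eq_of_subset_of_forall_sdiff_eq_zero hEopen.measurableSet hKE
      fun x hx => by rw [hzero x hx.2, zero_mul]
  have hconst : ∀ c : ℝ, ∫ x in K, c * g (x - δ • y) ∂μ = c * ∫ x, g x ∂μ := by
    intro c
    rw [setIntegral_eq_integral_of_forall_compl_eq_zero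
      fun x hx => by rw [hzero x hx, mul_zero], integral_const_mul,
      integral_sub_right_eq_self g]
  have hKcomp : IsCompact K := isCompact_closedBall _ _
  have hgt : Continuous fun x => g (x - δ • y) := hgcont.comp (continuous_id.sub continuous_const)
  have hint : IntegrableOn (fun x => g (x - δ • y) * w x) K μ :=
    (hgt.continuousOn.mul (hwcont.mono hKE)).integrableOn_compact hKcomp
  have hintc : ∀ c : ℝ, IntegrableOn (fun x => c * g (x - δ • y)) K μ := fun c =>
    (continuous_const.mul hgt).continuousOn.integrableOn_compact hKcomp
  have hδτ : 0 ≤ δ ^ τ := Real.rpow_nonneg hδ.le τ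
  rw [hEK, ← hconst, ← hconst]
  constructor
  · refine setIntegral_mono_on (hintc _) hint hKcomp.measurableSet fun x hx => ?_
    rw [mul_comm, hw x hx]
    exact mul_le_mul_of_nonneg_left (mul_le_mul_of_nonneg_left (hamin (hscale x hx)) hδτ)
      (hgnonneg _)
  · refine setIntegral_mono_on hint (hintc _) hKcomp.measurableSet fun x hx => ?_
    rw [mul_comm (δ ^ τ * w b), hw x hx]
    exact mul_le_mul_of_nonneg_left (mul_le_mul_of_nonneg_left (hbmax (hscale x hx)) hδτ)
      (hgnonneg _)

/-- Comparison of powers at infinity. -/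
theorem Real.le_of_eventually_mul_rpow_le {a b c d : ℝ} (hc : 0 < c)
    (h : ∀ᶠ x : ℝ in Filter.atTop, c * x ^ a ≤ d * x ^ b) : a ≤ b := by
  by_contra! hab
  have ht := tendsto_rpow_atTop (sub_pos.2 hab)
  obtain ⟨x, hx, hxd, hx0⟩ :=
    (h.and ((ht.eventually_gt_atTop (d / c)).and (Filter.eventually_gt_atTop 0))).exists
  have hxb : 0 < x ^ b := Real.rpow_pos_of_pos hx0 b
  rw [Real.rpow_sub hx0, div_lt_div_iff₀ hc hxb] at hxd
  linarith

theorem stmt_16 {n : ℕ} (hn : 2 ≤ n) (E : Set (EuclideanSpace ℝ (Fin n)))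
    (hEopen : IsOpen E) (hEconv : Convex ℝ E) (hEne : E.Nonempty)
    (hcone : ∀ l : ℝ, 0 < l → ∀ x ∈ E, l • x ∈ E)
    (ω σ : EuclideanSpace ℝ (Fin n) → ℝ) (p q τ α K₀ : ℝ)
    (hp : 0 < p) (hq : 0 < q) (hK : 0 < K₀)
    (hωpos : ∀ x ∈ E, 0 < ω x) (hσpos : ∀ x ∈ E, 0 < σ x)
    (hωcont : ContinuousOn ω E) (hσcont : ContinuousOn σ E)
    (hωhom : ∀ l : ℝ, 0 < l → ∀ x ∈ E, ω (l • x) = l ^ τ * ω x)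
    (hσhom : ∀ l : ℝ, 0 < l → ∀ x ∈ E, σ (l • x) = l ^ α * σ x)
    (hWSI : ∀ u : EuclideanSpace ℝ (Fin n) → ℝ, ContDiff ℝ (⊤ : ℕ∞) u → HasCompactSupport u →
      (∫ x in E, |u x| ^ q * ω x) ^ (1 / q) ≤
        K₀ * (∫ x in E, ‖gradient u x‖ ^ p * σ x) ^ (1 / p)) :
    τ / q ≤ α / p := by
  obtain ⟨y, hy⟩ := hEne
  let v : ContDiffBump (0 : EuclideanSpace ℝ (Fin n)) := ⟨1 / 2, 1, by norm_num, by norm_num⟩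
  have hv : ContDiff ℝ (⊤ : ℕ∞) v := v.contDiff
  have hvsupp : tsupport v = Metric.closedBall 0 1 := v.tsupport_eq
  have hnorm : ∀ (u : EuclideanSpace ℝ (Fin n) → ℝ) x, ‖gradient u x‖ = ‖fderiv ℝ u x‖ :=
    fun u x => LinearIsometryEquiv.norm_map _ _
  have hgcont : Continuous fun x => |v x| ^ q :=
    v.continuous.abs.rpow_const fun _ => Or.inr hq.le
  have hgsupp : ∀ x, x ∉ Metric.closedBall (0 : EuclideanSpace ℝ (Fin n)) 1 → |v x| ^ q = 0 := by
    intro x hx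
    rw [← hvsupp] at hx
    rw [image_eq_zero_of_notMem_tsupport hx, abs_zero, Real.zero_rpow hq.ne']
  have hdcont : Continuous fun x => ‖fderiv ℝ v x‖ ^ p :=
    (hv.continuous_fderiv (by simp)).norm.rpow_const fun _ => Or.inr hp.le
  have hdsupp : ∀ x, x ∉ Metric.closedBall (0 : EuclideanSpace ℝ (Fin n)) 1 →
      ‖fderiv ℝ v x‖ ^ p = 0 := by
    intro x hx
    rw [← hvsupp] at hx
    rw [fderiv_of_notMem_tsupport ℝ hx, norm_zero, Real.zero_rpow hp.ne']
  obtain ⟨m, _, hm, _, hω⟩ := exists_bounds_setIntegral_translate_mul_homogeneous volume hEopen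
    hcone hy hωpos hωcont hωhom hgcont (fun x => by positivity) hgsupp
  obtain ⟨_, M, _, hM, hσ⟩ := exists_bounds_setIntegral_translate_mul_homogeneous volume hEopen
    hcone hy hσpos hσcont hσhom hdcont (fun x => by positivity) hdsupp
  set A := ∫ x, |v x| ^ q
  set B := ∫ x, ‖fderiv ℝ v x‖ ^ p
  have hApos : 0 < A := by
    refine hgcont.integral_pos_of_hasCompactSupport_nonneg_nonzero
      (HasCompactSupport.intro (isCompact_closedBall 0 1) hgsupp) (fun x => by positivity)
      (x := 0) ?_
    rw [v.one_of_mem_closedBall (Metric.mem_closedBall_self v.rIn_pos.le)]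
    simp
  have hB0 : 0 ≤ B := integral_nonneg fun x => by positivity
  refine Real.le_of_eventually_mul_rpow_le (c := (m * A) ^ (1 / q))
    (d := K₀ * (M * B) ^ (1 / p)) (by positivity) ?_
  filter_upwards [hω, hσ, Filter.eventually_gt_atTop 0] with δ hωδ hσδ hδ
  have hu := hWSI (fun x => v (x - δ • y)) (hv.comp (contDiff_id.sub contDiff_const))
    (v.hasCompactSupport.comp_homeomorph (Homeomorph.subRight (δ • y)))
  simp only [hnorm, fderiv_comp_sub] at hu
  have hδτ : 0 ≤ δ ^ τ := Real.rpow_nonneg hδ.le τ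
  have hδα : 0 ≤ δ ^ α := Real.rpow_nonneg hδ.le α
  have hexp : ∀ s t C : ℝ, 0 ≤ C → (δ ^ s * C) ^ (1 / t) = C ^ (1 / t) * δ ^ (s / t) := by
    intro s t C hC
    rw [Real.mul_rpow (Real.rpow_nonneg hδ.le s) hC, ← Real.rpow_mul hδ.le, mul_one_div, mul_comm]
  calc (m * A) ^ (1 / q) * δ ^ (τ / q) = (δ ^ τ * m * A) ^ (1 / q) := by
        rw [mul_assoc, hexp _ _ _ (by positivity)]
    _ ≤ (∫ x in E, |v (x - δ • y)| ^ q * ω x) ^ (1 / q) :=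
        Real.rpow_le_rpow (by positivity) hωδ.1 (by positivity)
    _ ≤ K₀ * (∫ x in E, ‖fderiv ℝ v (x - δ • y)‖ ^ p * σ x) ^ (1 / p) := hu
    _ ≤ K₀ * (δ ^ α * M * B) ^ (1 / p) := by
        refine mul_le_mul_of_nonneg_left (Real.rpow_le_rpow ?_ hσδ.2 (by positivity)) hK.le
        exact setIntegral_nonneg hEopen.measurableSet fun x hx =>
          mul_nonneg (by positivity) (hσpos x hx).le
    _ = K₀ * (M * B) ^ (1 / p) * δ ^ (α / p) := by
        rw [mul_assoc (δ ^ α), hexp _ _ _ (by positivity), mul_assoc]
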